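/- Let n ≥ 1 and c ≥ 0 be integers. Then, in ℚ(q): U_{n,c}(0)·W_{n,c}(−n) − U_{n,c}(−n)·W_{n,c}(0) = ( 2·(∏_{i=1}^{n−1} (1−q^{2i})/(1−q^2))·(1+q)^{2n−1} / q^{c(n−1)+2n(n−1)} ) · E, where E = (1/(1+q))·∏_{i=0}^{n−2} (1−q^{c+2+2i})/(1−q^2) if c is even, and E = ( ∏_{i=0}^{n−1} (1−q^{c+1+2i})/(1−q^2) )·(1−q)/(1−q^{c+n}) if c is odd. -/

import Mathlib

open Finset

noncomputable def q : RatFunc ℚ := RatFunc.X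

noncomputable def qb (a : ℤ) : RatFunc ℚ := (1 - q ^ a) / (1 - q)

noncomputable def qfac (a : ℤ) (n : ℕ) : RatFunc ℚ := ∏ i ∈ Finset.range n, qb (a + i)

noncomputable def binq (n k : ℤ) : RatFunc ℚ :=
  if 0 ≤ k ∧ k ≤ n then qfac (n - k + 1) k.toNat / qfac 1 k.toNat else 0

noncomputable def Wnc (n c : ℕ) (k : ℤ) : RatFunc ℚ :=
  qfac (k + 1) (n - 1) * qfac (k - c - n + 1) (n - 1)

noncomputable def Unc (n c : ℕ) (k : ℤ) : RatFunc ℚ :=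
  (-1 : RatFunc ℚ) ^ n * q ^ (((n : ℤ) - 1) * (2 * c + n) / 2) *
    (∑ i ∈ Finset.Icc 1 (n - 1),
      ((-1 : RatFunc ℚ) ^ c * q ^ (i * (i - 1) / 2) *
          (qfac (k + 1) (n - 1) * qfac (k - c - i + 1) (i - 1) *
            qfac (k - c - n + 1) (n - i - 1)) -
        q ^ (i * (i - 1) / 2) *
          (qfac (k + 1) (i - 1) * qfac (k + i + 1) (n - i - 1) *
            qfac (k - c - n + 1) (n - 1))) /
      (qfac 1 (i - 1) * qfac 1 (n - 1 - i) * qfac (c + i + 1) (n - 1))) +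
  (-1 : RatFunc ℚ) ^ k * q ^ (((n : ℤ) - 1) * k)

/-- The `p`-shifted factorial `(z; p)_n`. -/
def qPoch {K : Type*} [Field K] (p z : K) (n : ℕ) : K := ∏ j ∈ range n, (1 - z * p ^ j)

section qPoch

variable {K : Type*} [Field K] {p : K}

@[simp] lemma qPoch_zero (p z : K) : qPoch p z 0 = 1 := by simp [qPoch]

lemma qPoch_succ (p z : K) (n : ℕ) : qPoch p z (n + 1) = qPoch p z n * (1 - z * p ^ n) := by
  simp [qPoch, prod_range_succ]

lemma qPoch_succ' (p z : K) (n : ℕ) : qPoch p z (n + 1) = (1 - z) * qPoch p (z * p) n := by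
  simp only [qPoch, prod_range_succ']
  rw [mul_comm]
  congr 1
  · simp
  · exact prod_congr rfl fun j _ => by ring

lemma qPoch_add (p z : K) (m n : ℕ) :
    qPoch p z (m + n) = qPoch p z m * qPoch p (z * p ^ m) n := by
  induction n with
  | zero => simp
  | succ n ih => rw [← add_assoc, qPoch_succ, ih, qPoch_succ]; ring

lemma qPoch_ne_zero {z : K} (h : ∀ j, 1 - z * p ^ j ≠ 0) (n : ℕ) : qPoch p z n ≠ 0 :=
  prod_ne_zero_iff.2 fun j _ => h j

lemma qPoch_reflect (hp : p ≠ 0) {z : K} (hz : z ≠ 0) (n : ℕ) :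
    qPoch p ((z * p ^ n)⁻¹ * p) n = (-1) ^ n / (z ^ n * p ^ n.choose 2) * qPoch p z n := by
  induction n with
  | zero => simp
  | succ n ih =>
    have e : (z * p ^ (n + 1))⁻¹ * p = (z * p ^ n)⁻¹ := by
      rw [pow_succ]
      field_simp
    rw [qPoch_succ', e, ih, qPoch_succ, Nat.choose_succ_succ' n 1, Nat.choose_one_right]
    field_simp
    ring

lemma qPoch_two_mul_add_one (p z : K) (n : ℕ) :
    qPoch p z (2 * n + 1) =
      (∏ j ∈ range (n + 1), (1 - z * p ^ (2 * j))) * ∏ j ∈ range n, (1 - z * p ^ (2 * j + 1)) := by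
  induction n with
  | zero => simp [qPoch]
  | succ n ih =>
    rw [show 2 * (n + 1) + 1 = 2 * n + 1 + 1 + 1 by ring, qPoch_succ, qPoch_succ, ih,
      prod_range_succ _ (n + 1), prod_range_succ (fun j => 1 - z * p ^ (2 * j + 1))]
    ring

lemma qPoch_self_mul_prod_one_add (p : K) (n : ℕ) :
    qPoch p p n * ∏ j ∈ range n, (1 + p ^ (j + 1)) = ∏ j ∈ range n, (1 - p ^ (2 * (j + 1))) := by
  rw [qPoch, ← prod_mul_distrib]
  exact prod_congr rfl fun j _ => by ring

variable {x : K}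

/-- The terms of the terminating very-well-poised series summed in `sum_vwpTerm`; the term of
index `0` is simplified so that `x = 1` is allowed. -/
def vwpTerm (p x : K) (n : ℕ) : ℕ → K
  | 0 => 1 / (qPoch p p n * qPoch p (x * p) n)
  | j + 1 => p ^ (j + 1).choose 2 * (1 - x * p ^ (2 * j + 2)) /
      (qPoch p p (j + 1) * qPoch p p (n - (j + 1)) * qPoch p (x * p ^ (j + 1)) (n + 1))

lemma qPoch_self_ne_zero (hp : ∀ k : ℕ, 1 - p ^ (k + 1) ≠ 0) (m : ℕ) : qPoch p p m ≠ 0 :=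
  qPoch_ne_zero (fun j => by simpa [pow_succ'] using hp j) m

lemma qPoch_mul_pow_ne_zero (hx : ∀ k : ℕ, 1 - x * p ^ (k + 1) ≠ 0) (k m : ℕ) :
    qPoch p (x * p ^ (k + 1)) m ≠ 0 :=
  qPoch_ne_zero (fun j => by
    have := hx (k + j)
    rwa [show k + j + 1 = k + 1 + j by ring, pow_add, ← mul_assoc] at this) m

/-- Partial sums of the telescoping behind `sum_vwpTerm`. -/
lemma sum_vwpTerm_sub (hp : ∀ k : ℕ, 1 - p ^ (k + 1) ≠ 0)
    (hx : ∀ k : ℕ, 1 - x * p ^ (k + 1) ≠ 0) (n k : ℕ) (hk : k ≤ n) :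
    ∑ i ∈ range (k + 1), (vwpTerm p x (n + 1) i -
        (1 + p ^ n) / ((1 - p ^ (n + 1)) * (1 - x * p ^ (2 * n + 1))) * vwpTerm p x n i) =
      p ^ k.choose 2 * (x * p ^ (2 * k + 1) - 1) /
        (qPoch p p k * qPoch p p (n - k) * qPoch p (x * p ^ (k + 1)) (n + 1)) *
        (p ^ n / ((1 - p ^ (n + 1)) * (1 - x * p ^ (2 * n + 1)))) := by
  induction k with
  | zero =>
    have h1 := qPoch_self_ne_zero hp n
    have h2 := qPoch_mul_pow_ne_zero hx 0 n
    have h3 := hp n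
    have h4 := hx (2 * n)
    have h5 := hx n
    simp only [zero_add, pow_one] at h2
    simp only [range_one, sum_singleton, vwpTerm, Nat.choose_zero_succ, pow_zero, mul_zero,
      zero_add, pow_one, qPoch_zero, Nat.sub_zero, qPoch_succ]
    rw [← pow_succ', mul_assoc x, ← pow_succ']
    generalize qPoch p p n = A at *
    generalize qPoch p (x * p) n = B at *
    simp only [pow_add, pow_mul', pow_one] at *
    generalize p ^ n = N at *
    have h5' : 1 - N * p * x ≠ 0 := by convert h5 using 1; ring
    have h4' : 1 - N ^ 2 * p * x ≠ 0 := by convert h4 using 1; ring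
    field_simp
    ring
  | succ k ih =>
    obtain ⟨m, rfl⟩ : ∃ m, n = k + 1 + m := ⟨n - (k + 1), by omega⟩
    rw [sum_range_succ, ih (by omega)]
    have h1 := qPoch_self_ne_zero hp k
    have h2 := qPoch_self_ne_zero hp m
    have h3 := qPoch_mul_pow_ne_zero hx (k + 1) (k + 1 + m)
    have h4 := hp (k + 1 + m)
    have h5 := hx (2 * (k + 1 + m))
    have h6 := hp k
    have h7 := hp m
    have h8 := hx k
    have h9 := hx (k + 1 + (k + 1 + m))
    rw [show k + 1 + m - k = m + 1 by omega, show k + 1 + m - (k + 1) = m by omega]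
    simp only [vwpTerm]
    rw [show k + 1 + m + 1 - (k + 1) = m + 1 by omega, show k + 1 + m - (k + 1) = m by omega,
      qPoch_succ' p _ (k + 1 + m + 1), qPoch_succ' p _ (k + 1 + m), qPoch_succ p p m,
      qPoch_succ p p k, mul_assoc x _ p, ← pow_succ, qPoch_succ p _ (k + 1 + m),
      Nat.choose_succ_succ' k 1, Nat.choose_one_right]
    generalize qPoch p p k = A at *
    generalize qPoch p p m = B at *
    generalize qPoch p (x * p ^ (k + 1 + 1)) (k + 1 + m) = C at *
    simp only [pow_add, pow_mul', mul_add, pow_one] at *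
    generalize p ^ k = y at *
    generalize p ^ m = z at *
    generalize p ^ k.choose 2 = w at *
    have h8' : 1 - x * y * p ≠ 0 := by convert h8 using 1; ring
    have h9' : 1 - x * y ^ 2 * p ^ 3 * z ≠ 0 := by convert h9 using 1; ring
    have h4' : 1 - y * p ^ 2 * z ≠ 0 := by convert h4 using 1; ring
    have h5' : 1 - x * y ^ 2 * p ^ 3 * z ^ 2 ≠ 0 := by convert h5 using 1; ring
    have h7' : 1 - p * z ≠ 0 := by convert h7 using 1; ring
    field_simp
    ring

lemma sum_vwpTerm (hp : ∀ k : ℕ, 1 - p ^ (k + 1) ≠ 0)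
    (hx : ∀ k : ℕ, 1 - x * p ^ (k + 1) ≠ 0) (n : ℕ) :
    ∑ i ∈ range (n + 1), vwpTerm p x n i =
      (∏ j ∈ range n, (1 + p ^ j)) /
        (qPoch p p n * ∏ j ∈ range n, (1 - x * p ^ (2 * j + 1))) := by
  induction n with
  | zero => simp [vwpTerm]
  | succ n ih =>
    have h := sum_vwpTerm_sub hp hx n n le_rfl
    rw [sum_sub_distrib, ← mul_sum, ih, sub_eq_iff_eq_add] at h
    rw [sum_range_succ, h, vwpTerm, prod_range_succ, prod_range_succ, qPoch_succ p p n,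
      qPoch_succ p (x * p ^ (n + 1)) (n + 1), Nat.choose_succ_succ' n 1, Nat.choose_one_right]
    have h1 := qPoch_self_ne_zero hp n
    have h2 : ∏ j ∈ range n, (1 - x * p ^ (2 * j + 1)) ≠ 0 :=
      prod_ne_zero_iff.2 fun j _ => hx (2 * j)
    have h3 := qPoch_mul_pow_ne_zero hx n (n + 1)
    have h4 := hp n
    have h5 := hx (2 * n)
    have h6 := hx (2 * n + 1)
    rw [Nat.sub_self, Nat.sub_self, qPoch_zero]
    generalize qPoch p p n = A at *
    generalize qPoch p (x * p ^ (n + 1)) (n + 1) = B at *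
    generalize ∏ j ∈ range n, (1 - x * p ^ (2 * j + 1)) = C at *
    simp only [pow_add, pow_mul', mul_add, pow_one] at *
    generalize p ^ n = N at *
    generalize p ^ n.choose 2 = w at *
    have h5' : 1 - x * N ^ 2 * p ≠ 0 := by convert h5 using 1; ring
    have h6' : 1 - x * N ^ 2 * p ^ 2 ≠ 0 := by convert h6 using 1; ring
    field_simp
    ring

/-- The terms of the terminating Kummer series summed in `sum_kummerTerm`. -/
def kummerTerm (p x : K) (n i : ℕ) : K :=
  p ^ (i + 1).choose 2 / (qPoch p p i * qPoch p p (n - i) * qPoch p (x * p ^ i) (n + 1))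

/-- Partial sums of the telescoping behind `sum_kummerTerm`. -/
lemma sum_kummerTerm_sub (hp : ∀ k : ℕ, 1 - p ^ (k + 1) ≠ 0)
    (hx : ∀ k : ℕ, 1 - x * p ^ k ≠ 0) (n k : ℕ) (hk : k ≤ n) :
    ∑ i ∈ range (k + 1), (kummerTerm p x (n + 1) i -
        (1 + p ^ (n + 1)) / ((1 - p ^ (n + 1)) * (1 - x * p ^ (2 * n + 2))) *
          kummerTerm p x n i) =
      - (p ^ (k + 1).choose 2 /
        (qPoch p p k * qPoch p p (n - k) * qPoch p (x * p ^ (k + 1)) (n + 1)) *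
        (p ^ (n + 1) / ((1 - p ^ (n + 1)) * (1 - x * p ^ (2 * n + 2))))) := by
  induction k with
  | zero =>
    have h1 := qPoch_self_ne_zero hp n
    have h2 := qPoch_mul_pow_ne_zero (fun k => hx (k + 1)) 0 n
    have h3 := hp n
    have h4 := hx (2 * n + 2)
    have h5 := hx (n + 1)
    have h6 := hx 0
    simp only [zero_add, pow_one, pow_zero, mul_one] at h2 h6
    simp only [range_one, sum_singleton, kummerTerm, qPoch_zero, Nat.sub_zero, qPoch_succ' p x,
      pow_zero, mul_one, zero_add, pow_one, Nat.choose_succ_self]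
    rw [qPoch_succ, qPoch_succ, ← pow_succ', mul_assoc x, ← pow_succ']
    generalize qPoch p p n = A at *
    generalize qPoch p (x * p) n = B at *
    simp only [pow_add, pow_mul', pow_one] at *
    generalize p ^ n = N at *
    have h5' : 1 - N * p * x ≠ 0 := by convert h5 using 1; ring
    have h4' : 1 - N ^ 2 * p ^ 2 * x ≠ 0 := by convert h4 using 1; ring
    field_simp
    ring
  | succ k ih =>
    obtain ⟨m, rfl⟩ : ∃ m, n = k + 1 + m := ⟨n - (k + 1), by omega⟩
    rw [sum_range_succ, ih (by omega)]
    have h1 := qPoch_self_ne_zero hp k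
    have h2 := qPoch_self_ne_zero hp m
    have h3 := qPoch_mul_pow_ne_zero (fun k => hx (k + 1)) (k + 1) (k + 1 + m)
    have h4 := hp (k + 1 + m)
    have h5 := hx (2 * (k + 1 + m) + 2)
    have h6 := hp k
    have h7 := hp m
    have h8 := hx (k + 1)
    have h9 := hx (k + 1 + (k + 1 + m) + 1)
    rw [show k + 1 + m - k = m + 1 by omega, show k + 1 + m - (k + 1) = m by omega]
    simp only [kummerTerm]
    rw [show k + 1 + m + 1 - (k + 1) = m + 1 by omega, show k + 1 + m - (k + 1) = m by omega,
      qPoch_succ' p _ (k + 1 + m + 1), qPoch_succ' p _ (k + 1 + m), qPoch_succ p p m,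
      qPoch_succ p p k, mul_assoc x _ p, ← pow_succ, qPoch_succ p _ (k + 1 + m),
      Nat.choose_succ_succ' (k + 1) 1, Nat.choose_one_right]
    generalize qPoch p p k = A at *
    generalize qPoch p p m = B at *
    generalize qPoch p (x * p ^ (k + 1 + 1)) (k + 1 + m) = C at *
    generalize (k + 1).choose 2 = l
    simp only [pow_add, pow_mul', mul_add, pow_one] at *
    generalize p ^ k = y at *
    generalize p ^ m = z at *
    generalize p ^ l = w at *
    have h8' : 1 - p * x * y ≠ 0 := by convert h8 using 1; ring
    have h9' : 1 - p ^ 3 * z * x * y ^ 2 ≠ 0 := by convert h9 using 1; ring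
    have h4' : 1 - p ^ 2 * z * y ≠ 0 := by convert h4 using 1; ring
    have h5' : 1 - p ^ 4 * z ^ 2 * x * y ^ 2 ≠ 0 := by convert h5 using 1; ring
    have h7' : 1 - p * z ≠ 0 := by convert h7 using 1; ring
    have h6' : 1 - p * y ≠ 0 := by convert h6 using 1; ring
    field_simp
    ring

lemma sum_kummerTerm (hp : ∀ k : ℕ, 1 - p ^ (k + 1) ≠ 0)
    (hx : ∀ k : ℕ, 1 - x * p ^ k ≠ 0) (n : ℕ) :
    ∑ i ∈ range (n + 1), kummerTerm p x n i =
      (∏ j ∈ range n, (1 + p ^ (j + 1))) /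
        (qPoch p p n * (1 - x) * ∏ j ∈ range n, (1 - x * p ^ (2 * j + 2))) := by
  induction n with
  | zero => simp [kummerTerm, qPoch_succ]
  | succ n ih =>
    have h := sum_kummerTerm_sub hp hx n n le_rfl
    rw [sum_sub_distrib, ← mul_sum, ih, sub_eq_iff_eq_add] at h
    rw [sum_range_succ, h, kummerTerm, prod_range_succ, prod_range_succ, qPoch_succ p p n,
      qPoch_succ p (x * p ^ (n + 1)) (n + 1), Nat.choose_succ_succ' (n + 1) 1, Nat.choose_one_right]
    have h1 := qPoch_self_ne_zero hp n
    have h2 : ∏ j ∈ range n, (1 - x * p ^ (2 * j + 2)) ≠ 0 :=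
      prod_ne_zero_iff.2 fun j _ => hx (2 * j + 2)
    have h3 := qPoch_mul_pow_ne_zero (fun k => hx (k + 1)) n (n + 1)
    have h4 := hp n
    have h5 := hx (2 * n + 2)
    have h6 := hx 0
    rw [Nat.sub_self, Nat.sub_self, qPoch_zero]
    generalize qPoch p p n = A at *
    generalize qPoch p (x * p ^ (n + 1)) (n + 1) = B at *
    generalize ∏ j ∈ range n, (1 - x * p ^ (2 * j + 2)) = C at *
    generalize (n + 1).choose 2 = l
    simp only [pow_add, pow_mul', mul_add, pow_one, pow_zero, mul_one] at *
    generalize p ^ n = N at *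
    generalize p ^ l = w at *
    have h5' : 1 - N ^ 2 * p ^ 2 * x ≠ 0 := by convert h5 using 1; ring
    field_simp
    ring

/-- The general term of the series arising for odd `c`, which is reduced to the Kummer series. -/
def reducedTerm (p x : K) (n i : ℕ) : K :=
  p ^ i.choose 2 * ((1 + x * p ^ n) * (1 + x * p ^ (2 * i)) - 2 * x * p ^ i * (1 + p ^ n)) /
    (qPoch p p i * qPoch p p (n - i) * qPoch p (x * p ^ i) (n + 1))

lemma sum_contiguous (hp : ∀ k : ℕ, 1 - p ^ (k + 1) ≠ 0) (hx : ∀ k : ℕ, 1 - x * p ^ k ≠ 0)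
    (n k : ℕ) (hk : k ≤ n) :
    ∑ i ∈ range (k + 1), p ^ i.choose 2 *
        ((1 + p ^ n) * (1 + x * p ^ (2 * i)) - 2 * p ^ i * (1 + x * p ^ n)) /
        (qPoch p p i * qPoch p p (n - i) * qPoch p (x * p ^ i) (n + 1)) =
      p ^ k.choose 2 * ((p ^ n - p ^ k) * (1 - x * p ^ k)) /
        (qPoch p p k * qPoch p p (n - k) * qPoch p (x * p ^ k) (n + 1)) := by
  induction k with
  | zero =>
    simp only [zero_add, range_one, sum_singleton]
    ring
  | succ k ih =>
    obtain ⟨m, rfl⟩ : ∃ m, n = k + 1 + m := ⟨n - (k + 1), by omega⟩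
    rw [sum_range_succ, ih (by omega)]
    have h1 := qPoch_self_ne_zero hp k
    have h2 := qPoch_self_ne_zero hp m
    have h3 := qPoch_mul_pow_ne_zero (fun k => hx (k + 1)) k (k + 1 + m)
    have h5 := hx k
    have h6 := hp k
    have h7 := hp m
    have h9 := hx (k + 1 + (k + 1 + m))
    rw [show k + 1 + m - k = m + 1 by omega, show k + 1 + m - (k + 1) = m by omega,
      qPoch_succ' p (x * p ^ k), qPoch_succ p p m, mul_assoc x _ p, ← pow_succ,
      qPoch_succ p (x * p ^ (k + 1)), qPoch_succ p p k, Nat.choose_succ_succ' k 1,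
      Nat.choose_one_right]
    generalize qPoch p p k = A at *
    generalize qPoch p p m = B at *
    generalize qPoch p (x * p ^ (k + 1)) (k + 1 + m) = C at *
    simp only [pow_add, pow_mul', mul_add, pow_one] at *
    generalize p ^ k = y at *
    generalize p ^ m = z at *
    generalize p ^ k.choose 2 = w at *
    have h7' : 1 - p * z ≠ 0 := by convert h7 using 1; ring
    have h5' : 1 - y * x ≠ 0 := by convert h5 using 1; ring
    have h9' : 1 - y ^ 2 * p ^ 2 * z * x ≠ 0 := by convert h9 using 1; ring
    field_simp
    ring

lemma sum_reducedTerm (hp : ∀ k : ℕ, 1 - p ^ (k + 1) ≠ 0) (hx : ∀ k : ℕ, 1 - x * p ^ k ≠ 0)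
    (n : ℕ) (hn : 1 + p ^ n ≠ 0) :
    ∑ i ∈ range (n + 1), reducedTerm p x n i =
      2 * (1 - x) * (1 - x * p ^ (2 * n)) / (1 + p ^ n) *
        ∑ i ∈ range (n + 1), kummerTerm p x n i := by
  have h := sum_contiguous hp hx n n le_rfl
  rw [sub_self, zero_mul, mul_zero, zero_div] at h
  rw [← add_zero (_ * ∑ i ∈ range (n + 1), kummerTerm p x n i),
    ← mul_zero ((1 + x * p ^ n) / (1 + p ^ n)), ← h, mul_sum, mul_sum, ← sum_add_distrib]
  refine sum_congr rfl fun i _ => ?_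
  rw [reducedTerm, kummerTerm, Nat.choose_succ_succ' i 1, Nat.choose_one_right, pow_add]
  simp only [pow_mul']
  generalize qPoch p p i * qPoch p p (n - i) * qPoch p (x * p ^ i) (n + 1) = A
  field_simp
  ring

end qPoch

lemma one_sub_q_pow_ne_zero (k : ℕ) : 1 - q ^ (k + 1) ≠ 0 := by
  have h : (1 - Polynomial.X ^ (k + 1) : Polynomial ℚ) ≠ 0 := fun h => by
    simpa using congrArg (Polynomial.eval 0) h
  have := (map_ne_zero_iff _ (RatFunc.algebraMap_injective ℚ)).2 h
  simpa [q] using this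

lemma one_add_q_pow_ne_zero (k : ℕ) : 1 + q ^ k ≠ 0 := by
  have h : (1 + Polynomial.X ^ k : Polynomial ℚ) ≠ 0 := fun h => by
    have := congrArg (Polynomial.eval 1) h
    norm_num at this
  have := (map_ne_zero_iff _ (RatFunc.algebraMap_injective ℚ)).2 h
  simpa [q] using this

lemma q_ne_zero : q ≠ 0 := RatFunc.X_ne_zero

lemma one_sub_q_ne_zero : 1 - q ≠ 0 := by simpa using one_sub_q_pow_ne_zero 0

lemma qPoch_q_pow_mul_q_ne_zero (a m : ℕ) : qPoch q (q ^ a * q) m ≠ 0 :=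
  qPoch_ne_zero (fun k => by
    convert one_sub_q_pow_ne_zero (a + k) using 2
    ring) m

lemma qfac_eq_qPoch (a : ℤ) (n : ℕ) : qfac a n = qPoch q (q ^ a) n / (1 - q) ^ n := by
  simp only [qfac, qb, prod_div_distrib, prod_const, card_range, qPoch]
  congr 1
  exact prod_congr rfl fun j _ => by rw [zpow_add₀ q_ne_zero, zpow_natCast]

lemma qfac_neg (a n : ℕ) :
    qfac (-(a + n : ℤ) + 1) n =
      (-1) ^ n / (q ^ (a * n + n.choose 2)) * (qPoch q (q ^ a) n / (1 - q) ^ n) := by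
  rw [qfac_eq_qPoch, zpow_add₀ q_ne_zero, zpow_neg, zpow_one]
  have : q ^ ((a : ℤ) + n) = q ^ a * q ^ n := by rw [← pow_add]; norm_cast
  rw [this, qPoch_reflect q_ne_zero (pow_ne_zero _ q_ne_zero), ← pow_mul, ← pow_add]
  ring

lemma qfac_split (a : ℤ) (j l : ℕ) :
    qfac a (j + 1 + l) = qfac a j * qb (a + j) * qfac (a + j + 1) l := by
  simp only [qfac, prod_range_add, prod_range_succ]
  push_cast
  simp only [add_assoc]

lemma sum_Icc_one_eq_sum_range {M : Type*} [AddCommMonoid M] (f : ℕ → M) (m : ℕ) :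
    ∑ i ∈ Icc 1 m, f i = ∑ j ∈ range m, f (j + 1) := by
  rw [range_eq_Ico, sum_Ico_add' f 0 m 1]
  rfl

/-- `Unc` with the factor `Wnc` taken out of the sum. -/
lemma Unc_eq (m c : ℕ) (k : ℤ) (h₁ : ∀ j < m, qb (k - c - (j + 1)) ≠ 0)
    (h₂ : ∀ j < m, qb (k + (j + 1)) ≠ 0) :
    Unc (m + 1) c k = Wnc (m + 1) c k * ((-1) ^ (m + 1) * q ^ (m * (c + 1) + m.choose 2) *
      ∑ j ∈ range m, q ^ (j + 1).choose 2 *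
        ((-1) ^ c / qb (k - c - (j + 1)) - 1 / qb (k + (j + 1))) /
        (qfac 1 j * qfac 1 (m - (j + 1)) * qfac (c + (j + 1) + 1) m)) +
      (-1) ^ k * q ^ (m * k) := by
  have hexp : ((((m + 1 : ℕ) : ℤ) - 1) * (2 * c + (m + 1 : ℕ)) / 2) =
      ((m * (c + 1) + m.choose 2 : ℕ) : ℤ) := by
    have h : ((m.choose 2 : ℕ) : ℤ) * 2 = m * (m - 1) := by
      rw [Nat.choose_two_right]
      have := Nat.div_mul_cancel (Nat.even_mul_pred_self m).two_dvd
      have h' : ((m * (m - 1) : ℕ) : ℤ) = m * (m - 1) := by cases m <;> simp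
      rw [← h']
      exact_mod_cast this
    apply Int.ediv_eq_of_eq_mul_left (by norm_num)
    push_cast
    linear_combination -h
  rw [Unc, hexp, zpow_natCast, Nat.add_sub_cancel, sum_Icc_one_eq_sum_range,
    mul_left_comm (Wnc (m + 1) c k)]
  congr 1
  · congr 1
    rw [mul_sum]
    refine sum_congr rfl fun j hj => ?_
    obtain ⟨l, rfl⟩ : ∃ l, m = j + 1 + l := ⟨m - (j + 1), by have := mem_range.1 hj; omega⟩
    have e₁ := h₁ j (by omega)
    have e₂ := h₂ j (by omega)
    have w₁ : qfac (k + 1) (j + 1 + l) =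
        qfac (k + 1) j * qb (k + (j + 1)) * qfac (k + (j + 1 : ℕ) + 1) l := by
      rw [qfac_split]
      push_cast
      ring_nf
    have w₂ : qfac (k - c - (j + 1 + l + 1 : ℕ) + 1) (j + 1 + l) =
        qfac (k - c - (j + 1 + l + 1 : ℕ) + 1) l * qb (k - c - (j + 1)) *
          qfac (k - c - (j + 1 : ℕ) + 1) j := by
      rw [show j + 1 + l = l + 1 + j by ring, qfac_split]
      push_cast
      ring_nf
    rw [show j + 1 + l + 1 - (j + 1) - 1 = l by omega, Nat.add_sub_cancel,
      show j + 1 + l - (j + 1) = l by omega, Wnc, Nat.add_sub_cancel, w₁, w₂,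
      Nat.choose_two_right, Nat.add_sub_cancel, mul_div_assoc',
      show (c : ℤ) + (j + 1) + 1 = c + (j + 1 : ℕ) + 1 by push_cast; ring]
    congr 1
    field_simp
  · push_cast
    rw [add_sub_cancel_right]

lemma Wnc_zero (m c : ℕ) :
    Wnc (m + 1) c 0 = (-1) ^ m * (qPoch q q m * qPoch q (q ^ c * q) m) /
      ((1 - q) ^ (2 * m) * q ^ (m * (c + 1) + m.choose 2)) := by
  have h : (0 : ℤ) - c - (m + 1 : ℕ) + 1 = -(((c + 1 : ℕ) : ℤ) + m) + 1 := by push_cast; ring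
  have h' : (q : RatFunc ℚ) ^ ((0 : ℤ) + 1) = q := by simp
  rw [Wnc, Nat.add_sub_cancel, h, qfac_neg, qfac_eq_qPoch, h', pow_succ q c, mul_comm m (c + 1)]
  ring

lemma Wnc_neg (m c : ℕ) :
    Wnc (m + 1) c (-(m + 1 : ℕ)) = qPoch q q m * qPoch q (q ^ c * q ^ (m + 1) * q) m /
      ((1 - q) ^ (2 * m) * q ^ (c * m + 2 * (m + 1) * m)) := by
  have h : (-(m + 1 : ℕ) : ℤ) + 1 = -((1 : ℕ) + m : ℤ) + 1 := by push_cast; ring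
  have h' : (-(m + 1 : ℕ) : ℤ) - c - (m + 1 : ℕ) + 1 = -(((c + (m + 1) + 1 : ℕ) : ℤ) + m) + 1 := by
    push_cast; ring
  have e : c * m + 2 * (m + 1) * m = 1 * m + m.choose 2 + ((c + (m + 1) + 1) * m + m.choose 2) := by
    have h2 := Nat.choose_two_right m
    have h3 := Nat.div_mul_cancel (Nat.even_mul_pred_self m).two_dvd
    rw [← h2] at h3
    have h4 : m * (m - 1) + m = m * m := by cases m <;> simp; ring
    nlinarith
  have s : ((-1 : RatFunc ℚ) ^ m) * (-1) ^ m = 1 := by rw [← mul_pow]; simp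
  rw [Wnc, Nat.add_sub_cancel, h', h, qfac_neg, qfac_neg, e, pow_add q (1 * m + _), pow_one,
    pow_succ q (c + (m + 1)), pow_add q c]
  generalize qPoch q (q ^ c * q ^ (m + 1) * q) m = P
  have := q_ne_zero
  have := one_sub_q_ne_zero
  field_simp
  linear_combination qPoch q q m * P * (1 - q) ^ (2 * m) * s

/-- The interior terms of the sum in `Unc_mul_Wnc_sub`. -/
noncomputable def midTerm (n c i : ℕ) : RatFunc ℚ :=
  q ^ i.choose 2 * ((1 - q ^ c * q ^ i) * (1 - q ^ c * q ^ i * q ^ n) +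
      (-1) ^ c * (q ^ c * q ^ i * (1 - q ^ i) * (1 - q ^ (n - i)))) /
    (qPoch q q i * qPoch q q (n - i) * qPoch q (q ^ c * q ^ i) (n + 1))

lemma qb_natCast (a : ℕ) : qb a = (1 - q ^ a) / (1 - q) := by rw [qb, zpow_natCast]

lemma qb_neg_natCast (a : ℕ) : qb (-(a : ℤ)) = -(1 - q ^ a) / (q ^ a * (1 - q)) := by
  have := pow_ne_zero a q_ne_zero
  rw [qb, zpow_neg, zpow_natCast]
  field_simp
  ring

lemma weight_mul_sub (c j l : ℕ) :
    q ^ (j + 1).choose 2 / (qfac 1 j * qfac 1 l * qfac (c + (j + 1) + 1) (j + 1 + l)) *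
      (((-1) ^ c / qb (-(c + (j + 1) : ℕ)) - 1 / qb (j + 1 : ℕ)) -
        ((-1) ^ c / qb (-(c + (j + 1) + (j + 1 + l + 1) : ℕ)) - 1 / qb (-(l + 1 : ℕ)))) =
      -((1 - q) ^ (2 * (j + 1 + l)) * (1 - q ^ (j + 1 + l + 1)) *
        midTerm (j + 1 + l + 1) c (j + 1)) := by
  have hz : (q : RatFunc ℚ) ^ ((c : ℤ) + (j + 1) + 1) = q ^ c * q ^ (j + 1) * q := by
    rw [← pow_add, ← pow_succ]; norm_cast
  rw [qb_natCast, qb_neg_natCast, qb_neg_natCast, qb_neg_natCast, qfac_eq_qPoch, qfac_eq_qPoch,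
    qfac_eq_qPoch, hz, zpow_one, midTerm, show j + 1 + l + 1 - (j + 1) = l + 1 by omega,
    qPoch_succ' q (q ^ c * q ^ (j + 1)), qPoch_succ q _ (j + 1 + l), qPoch_succ q q,
    qPoch_succ q q]
  have a₁ := one_sub_q_pow_ne_zero j
  have a₂ := one_sub_q_pow_ne_zero l
  have a₃ : 1 - q ^ c * q ^ (j + 1) ≠ 0 := by
    rw [← pow_add]; exact one_sub_q_pow_ne_zero (c + j)
  have a₄ : 1 - q ^ c * q ^ (j + 1) * (q ^ (j + 1) * q ^ (l + 1)) ≠ 0 := by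
    simp only [← pow_add]; exact one_sub_q_pow_ne_zero (c + (j + 1) + (j + 1 + l))
  have a₅ := one_sub_q_ne_zero
  have b₁ := qPoch_self_ne_zero one_sub_q_pow_ne_zero j
  have b₂ := qPoch_self_ne_zero one_sub_q_pow_ne_zero l
  have b₃ : qPoch q (q ^ c * q ^ (j + 1) * q) (j + 1 + l) ≠ 0 := by
    rw [← pow_add]; exact qPoch_q_pow_mul_q_ne_zero _ _
  have b₄ := pow_ne_zero c q_ne_zero
  have b₅ := pow_ne_zero (j + 1) q_ne_zero
  have b₆ := pow_ne_zero (l + 1) q_ne_zero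
  have d₀ := pow_ne_zero j a₅
  have d₁ := pow_ne_zero l a₅
  have d₂ := pow_ne_zero (j + 1 + l) a₅
  rw [mul_assoc (q ^ c * q ^ (j + 1)) q, ← pow_succ' q (j + 1 + l),
    show (1 - q) ^ (2 * (j + 1 + l)) =
      (1 - q) ^ j * (1 - q) ^ l * (1 - q) ^ (j + 1 + l) * (1 - q) by ring,
    ← pow_succ' q j, ← pow_succ' q l, pow_add q (c + (j + 1)), pow_add q c,
    show q ^ (j + 1 + l + 1) = q ^ (j + 1) * q ^ (l + 1) by rw [← pow_add, add_assoc (j + 1)]]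
  generalize qPoch q (q ^ c * q ^ (j + 1) * q) (j + 1 + l) = P₀ at *
  generalize qPoch q q j = P₁ at *
  generalize qPoch q q l = P₂ at *
  generalize (1 - q) ^ (j + 1 + l) = D₀ at *
  generalize (1 - q) ^ j = D₁ at *
  generalize (1 - q) ^ l = D₂ at *
  generalize 1 - q = d at *
  generalize q ^ (j + 1).choose 2 = w at *
  generalize q ^ (j + 1) = y at *
  generalize q ^ (l + 1) = z at *
  generalize q ^ c = x at *
  generalize (-1 : RatFunc ℚ) ^ c = ε at *
  replace a₄ : 1 - x * y ^ 2 * z ≠ 0 := by convert a₄ using 1; ring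
  field_simp
  ring

lemma qb_natCast_ne_zero (a : ℕ) : qb (a + 1 : ℕ) ≠ 0 := by
  rw [qb_natCast]
  exact div_ne_zero (one_sub_q_pow_ne_zero a) one_sub_q_ne_zero

lemma qb_neg_natCast_ne_zero (a : ℕ) : qb (-(a + 1 : ℕ)) ≠ 0 := by
  rw [qb_neg_natCast]
  exact div_ne_zero (neg_ne_zero.2 (one_sub_q_pow_ne_zero a))
    (mul_ne_zero (pow_ne_zero _ q_ne_zero) one_sub_q_ne_zero)

lemma Unc_mul_Wnc_sub (m c : ℕ) :
    Unc (m + 1) c 0 * Wnc (m + 1) c (-(m + 1 : ℕ)) -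
        Unc (m + 1) c (-(m + 1 : ℕ)) * Wnc (m + 1) c 0 =
      Wnc (m + 1) c (-(m + 1 : ℕ)) * (qPoch q q (m + 1) * qPoch q (q ^ c * q) m) *
        (1 / (qPoch q q (m + 1) * qPoch q (q ^ c * q) m) +
          ∑ j ∈ range m, midTerm (m + 1) c (j + 1) +
          q ^ (m + 1).choose 2 / (qPoch q q (m + 1) * qPoch q (q ^ c * q ^ (m + 1) * q) m)) := by
  have c₁ : ∀ j : ℕ, (0 : ℤ) - c - (j + 1) = -(c + (j + 1) : ℕ) := fun j => by push_cast; ring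
  have c₂ : ∀ j : ℕ, (0 : ℤ) + (j + 1) = (j + 1 : ℕ) := fun j => by push_cast; ring
  have c₃ : ∀ j : ℕ, (-(m + 1 : ℕ) : ℤ) - c - (j + 1) = -(c + (j + 1) + (m + 1) : ℕ) :=
    fun j => by push_cast; ring
  have c₄ : ∀ j < m, (-(m + 1 : ℕ) : ℤ) + (j + 1) = -(m - (j + 1) + 1 : ℕ) :=
    fun j hj => by omega
  rw [Unc_eq m c 0 (fun j _ => c₁ j ▸ qb_neg_natCast_ne_zero (c + j))
      (fun j _ => c₂ j ▸ qb_natCast_ne_zero j),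
    Unc_eq m c (-(m + 1 : ℕ)) (fun j _ => c₃ j ▸ qb_neg_natCast_ne_zero (c + (j + 1) + m))
      (fun j hj => c₄ j hj ▸ qb_neg_natCast_ne_zero _)]
  have hmid : ∑ j ∈ range m, q ^ (j + 1).choose 2 *
        ((-1) ^ c / qb (0 - c - (j + 1)) - 1 / qb (0 + (j + 1))) /
        (qfac 1 j * qfac 1 (m - (j + 1)) * qfac (c + (j + 1) + 1) m) -
      ∑ j ∈ range m, q ^ (j + 1).choose 2 *
        ((-1) ^ c / qb (-(m + 1 : ℕ) - c - (j + 1)) - 1 / qb (-(m + 1 : ℕ) + (j + 1))) /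
        (qfac 1 j * qfac 1 (m - (j + 1)) * qfac (c + (j + 1) + 1) m) =
      -((1 - q) ^ (2 * m) * (1 - q ^ (m + 1)) * ∑ j ∈ range m, midTerm (m + 1) c (j + 1)) := by
    rw [← sum_sub_distrib, mul_sum, ← sum_neg_distrib]
    refine sum_congr rfl fun j hj => ?_
    rw [c₁, c₂, c₃, c₄ j (mem_range.1 hj)]
    obtain ⟨l, rfl⟩ : ∃ l, m = j + 1 + l := ⟨m - (j + 1), by have := mem_range.1 hj; omega⟩
    rw [← weight_mul_sub, Nat.add_sub_cancel_left]
    ring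
  have s : ((-1 : RatFunc ℚ) ^ m) * (-1) ^ m = 1 := by rw [← mul_pow]; simp
  have hq := q_ne_zero
  have hd := one_sub_q_ne_zero
  have hN := one_sub_q_pow_ne_zero m
  have hW : (-1) ^ (m + 1) * q ^ (m * (c + 1) + m.choose 2) * Wnc (m + 1) c 0 *
      (1 - q) ^ (2 * m) = -(qPoch q q m * qPoch q (q ^ c * q) m) := by
    rw [Wnc_zero, pow_succ (-1 : RatFunc ℚ)]
    field_simp
    linear_combination -qPoch q q m * qPoch q (q ^ c * q) m * s
  have b₀ := qPoch_self_ne_zero one_sub_q_pow_ne_zero m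
  have b₁ : qPoch q (q ^ c * q) m ≠ 0 := qPoch_q_pow_mul_q_ne_zero c m
  have b₂ : qPoch q (q ^ c * q ^ (m + 1) * q) m ≠ 0 := by
    rw [← pow_add]; exact qPoch_q_pow_mul_q_ne_zero _ _
  have hQ : qPoch q q (m + 1) = qPoch q q m * (1 - q ^ (m + 1)) := by
    rw [qPoch_succ, ← pow_succ']
  have hend : Wnc (m + 1) c (-(m + 1 : ℕ)) * (qPoch q q (m + 1) * qPoch q (q ^ c * q) m) *
      (q ^ (m + 1).choose 2 / (qPoch q q (m + 1) * qPoch q (q ^ c * q ^ (m + 1) * q) m)) =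
      -((-1) ^ (-(m + 1 : ℕ) : ℤ) * q ^ ((m : ℤ) * (-(m + 1 : ℕ))) * Wnc (m + 1) c 0) := by
    have e : q ^ (c * m + 2 * (m + 1) * m) =
        q ^ (m * (m + 1)) * q ^ (m * (c + 1) + m.choose 2) * q ^ (m + 1).choose 2 := by
      rw [← pow_add, ← pow_add]
      congr 1
      have h2 := Nat.div_mul_cancel (Nat.even_mul_pred_self m).two_dvd
      rw [← Nat.choose_two_right] at h2
      have h4 : m * (m - 1) + m = m * m := by cases m <;> simp; ring
      rw [Nat.choose_succ_succ' m 1, Nat.choose_one_right]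
      nlinarith
    rw [mul_neg, zpow_neg, zpow_neg, zpow_natCast, ← Nat.cast_mul, zpow_natCast, Wnc_zero, Wnc_neg,
      hQ, e, pow_succ (-1 : RatFunc ℚ)]
    generalize qPoch q (q ^ c * q ^ (m + 1) * q) m = P at *
    generalize q ^ (m * (m + 1)) = P at *
    field_simp
  have hstart : Wnc (m + 1) c (-(m + 1 : ℕ)) * (qPoch q q (m + 1) * qPoch q (q ^ c * q) m) *
      (1 / (qPoch q q (m + 1) * qPoch q (q ^ c * q) m)) = Wnc (m + 1) c (-(m + 1 : ℕ)) := by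
    rw [hQ]
    field_simp
  simp only [mul_zero, zpow_zero, mul_one]
  linear_combination
    ((-1) ^ (m + 1) * q ^ (m * (c + 1) + m.choose 2) * Wnc (m + 1) c 0 *
      Wnc (m + 1) c (-(m + 1 : ℕ))) * hmid -
    (1 - q ^ (m + 1)) * (∑ j ∈ range m, midTerm (m + 1) c (j + 1)) *
      Wnc (m + 1) c (-(m + 1 : ℕ)) * hW - hend - hstart -
    Wnc (m + 1) c (-(m + 1 : ℕ)) * qPoch q (q ^ c * q) m *
      (∑ j ∈ range m, midTerm (m + 1) c (j + 1)) * hQ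

lemma qPoch_mul_pow_add_two {K : Type*} [Field K] (p x : K) (k m : ℕ) :
    qPoch p (x * p ^ k) (m + 2) =
      (1 - x * p ^ k) * qPoch p (x * p ^ k * p) m * (1 - x * p ^ k * p ^ (m + 1)) := by
  rw [qPoch_succ, qPoch_succ']

lemma sum_midTerm_of_even (m : ℕ) {c : ℕ} (hc : Even c) :
    1 / (qPoch q q (m + 1) * qPoch q (q ^ c * q) m) +
        ∑ j ∈ range m, midTerm (m + 1) c (j + 1) +
        q ^ (m + 1).choose 2 / (qPoch q q (m + 1) * qPoch q (q ^ c * q ^ (m + 1) * q) m) =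
      (1 - q ^ c * q ^ (m + 1)) * ∑ i ∈ range (m + 2), vwpTerm q (q ^ c) (m + 1) i := by
  have h₁ : 1 - q ^ c * q ^ (m + 1) ≠ 0 := by
    rw [← pow_add]; exact one_sub_q_pow_ne_zero (c + m)
  have h₂ : 1 - q ^ c * q ^ (m + 1) * q ^ (m + 1) ≠ 0 := by
    simp only [← pow_add]; exact one_sub_q_pow_ne_zero (c + (m + 1) + m)
  rw [sum_range_succ, sum_range_succ', mul_add, mul_add, add_comm (_ * ∑ j ∈ range m, _),
    mul_sum]
  congr 1
  · congr 1
    · rw [vwpTerm, qPoch_succ q (q ^ c * q) m, mul_assoc (q ^ c) q (q ^ m), ← pow_succ' q m]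
      generalize qPoch q q (m + 1) = P₁
      generalize qPoch q (q ^ c * q) m = P₂
      rw [mul_one_div, ← mul_assoc, mul_comm _ (1 - q ^ c * q ^ (m + 1)), div_mul_cancel_left₀ h₁,
        one_div]
    · refine sum_congr rfl fun j hj => ?_
      have hN : q ^ (m + 1) = q ^ (j + 1) * q ^ (m + 1 - (j + 1)) := by
        rw [← pow_add]; congr 1; have := mem_range.1 hj; omega
      rw [vwpTerm, midTerm, hc.neg_one_pow, mul_div_assoc']
      congr 1
      rw [hN]
      ring
  · rw [vwpTerm, Nat.sub_self, qPoch_zero, mul_one, qPoch_mul_pow_add_two]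
    generalize qPoch q (q ^ c * q ^ (m + 1) * q) m = P₁
    generalize qPoch q q (m + 1) = P₂
    rw [show 2 * m + 2 = (m + 1) * 2 by ring, pow_mul, pow_two]
    generalize q ^ (m + 1) = y at *
    generalize q ^ c = x at *
    have h₃ : 1 - x * y ^ 2 ≠ 0 := by convert h₂ using 1; ring
    field_simp

lemma sum_midTerm_of_odd (m : ℕ) {c : ℕ} (hc : Odd c) :
    1 / (qPoch q q (m + 1) * qPoch q (q ^ c * q) m) +
        ∑ j ∈ range m, midTerm (m + 1) c (j + 1) +
        q ^ (m + 1).choose 2 / (qPoch q q (m + 1) * qPoch q (q ^ c * q ^ (m + 1) * q) m) =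
      ∑ i ∈ range (m + 2), reducedTerm q (q ^ c) (m + 1) i := by
  have h₀ : 1 - q ^ c ≠ 0 := by
    obtain ⟨k, rfl⟩ := hc
    exact one_sub_q_pow_ne_zero _
  have h₁ : 1 - q ^ c * q ^ (m + 1) ≠ 0 := by
    rw [← pow_add]; exact one_sub_q_pow_ne_zero (c + m)
  have h₂ : 1 - q ^ c * q ^ (m + 1) * q ^ (m + 1) ≠ 0 := by
    simp only [← pow_add]; exact one_sub_q_pow_ne_zero (c + (m + 1) + m)
  rw [sum_range_succ, sum_range_succ', add_comm (∑ j ∈ range m, _)]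
  congr 1
  · congr 1
    · rw [reducedTerm, qPoch_mul_pow_add_two]
      simp only [pow_zero, mul_one, mul_zero, qPoch_zero, one_mul, Nat.sub_zero,
        Nat.choose_zero_succ]
      generalize qPoch q q (m + 1) = P₁
      generalize qPoch q (q ^ c * q) m = P₂
      generalize q ^ (m + 1) = y at *
      generalize q ^ c = x at *
      field_simp
      ring
    · refine sum_congr rfl fun j hj => ?_
      have hN : q ^ (m + 1) = q ^ (j + 1) * q ^ (m + 1 - (j + 1)) := by
        rw [← pow_add]; congr 1; have := mem_range.1 hj; omega
      rw [reducedTerm, midTerm, hc.neg_one_pow]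
      congr 1
      rw [hN]
      ring
  · rw [reducedTerm, Nat.sub_self, qPoch_zero, mul_one, qPoch_mul_pow_add_two]
    generalize qPoch q (q ^ c * q ^ (m + 1) * q) m = P₁
    generalize qPoch q q (m + 1) = P₂
    rw [mul_comm 2 (m + 1), pow_mul, pow_two]
    generalize q ^ (m + 1) = y at *
    generalize q ^ c = x at *
    have h₃ : 1 - x * y ^ 2 ≠ 0 := by convert h₂ using 1; ring
    field_simp
    ring

lemma qPoch_mul_qPoch_two_mul_add_one (m c : ℕ) :
    qPoch q (q ^ c * q) m * (1 - q ^ c * q ^ (m + 1)) * qPoch q (q ^ c * q ^ (m + 1) * q) m =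
      (∏ j ∈ range (m + 1), (1 - q ^ (c + 1 + 2 * j))) *
        ∏ j ∈ range m, (1 - q ^ (c + 2 + 2 * j)) := by
  have h := qPoch_two_mul_add_one q (q ^ c * q) m
  rw [show 2 * m + 1 = m + (m + 1) by ring, qPoch_add, qPoch_succ', ← mul_assoc,
    show q ^ c * q * q ^ m = q ^ c * q ^ (m + 1) by ring] at h
  rw [h]
  congr 1 <;> exact prod_congr rfl fun j _ => by ring

lemma Unc_mul_Wnc_sub_of_even (m : ℕ) {c : ℕ} (hc : Even c) :
    Unc (m + 1) c 0 * Wnc (m + 1) c (-(m + 1 : ℕ)) -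
        Unc (m + 1) c (-(m + 1 : ℕ)) * Wnc (m + 1) c 0 =
      2 * (∏ j ∈ range m, (1 - q ^ (2 * (j + 1)))) * (∏ j ∈ range m, (1 - q ^ (c + 2 + 2 * j))) /
        ((1 - q) ^ (2 * m) * q ^ (c * m + 2 * (m + 1) * m)) := by
  rw [Unc_mul_Wnc_sub, sum_midTerm_of_even m hc, Wnc_neg, sum_vwpTerm one_sub_q_pow_ne_zero
    (fun k => by rw [← pow_add]; exact one_sub_q_pow_ne_zero (c + k)), prod_range_succ',
    ← qPoch_self_mul_prod_one_add, pow_zero]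
  have h₁ := qPoch_mul_qPoch_two_mul_add_one m c
  have h₂ : ∏ j ∈ range (m + 1), (1 - q ^ c * q ^ (2 * j + 1)) =
      ∏ j ∈ range (m + 1), (1 - q ^ (c + 1 + 2 * j)) := prod_congr rfl fun j _ => by ring
  have h₃ : ∏ j ∈ range (m + 1), (1 - q ^ (c + 1 + 2 * j)) ≠ 0 := prod_ne_zero_iff.2 fun j _ => by
    convert one_sub_q_pow_ne_zero (c + 2 * j) using 2
    ring
  have h₄ := qPoch_self_ne_zero one_sub_q_pow_ne_zero (m + 1)
  have h₅ := pow_ne_zero (2 * m) one_sub_q_ne_zero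
  have h₆ := pow_ne_zero (c * m + 2 * (m + 1) * m) q_ne_zero
  rw [h₂]
  generalize qPoch q (q ^ c * q ^ (m + 1) * q) m = P₁ at *
  generalize ∏ j ∈ range (m + 1), (1 - q ^ (c + 1 + 2 * j)) = P₂ at *
  generalize ∏ j ∈ range m, (1 - q ^ (c + 2 + 2 * j)) = P₃ at *
  generalize ∏ j ∈ range m, (1 + q ^ (j + 1)) = P₄ at *
  generalize qPoch q (q ^ c * q) m = P₅ at *
  generalize qPoch q q m = P₆ at *
  generalize q ^ (c * m + 2 * (m + 1) * m) = e at *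
  generalize qPoch q q (m + 1) = P₇ at *
  generalize (1 - q) ^ (2 * m) = D at *
  generalize q ^ c * q ^ (m + 1) = y at *
  field_simp
  linear_combination 2 * P₆ * P₄ * h₁

lemma Unc_mul_Wnc_sub_of_odd (m : ℕ) {c : ℕ} (hc : Odd c) :
    Unc (m + 1) c 0 * Wnc (m + 1) c (-(m + 1 : ℕ)) -
        Unc (m + 1) c (-(m + 1 : ℕ)) * Wnc (m + 1) c 0 =
      2 * (∏ j ∈ range m, (1 - q ^ (2 * (j + 1)))) *
        (∏ j ∈ range (m + 1), (1 - q ^ (c + 1 + 2 * j))) /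
        ((1 - q) ^ (2 * m) * q ^ (c * m + 2 * (m + 1) * m) * (1 - q ^ (c + (m + 1)))) := by
  have h₀ : ∀ k : ℕ, 1 - q ^ c * q ^ k ≠ 0 := fun k => by
    obtain ⟨l, rfl⟩ := hc
    convert one_sub_q_pow_ne_zero (2 * l + k) using 2
    ring
  rw [Unc_mul_Wnc_sub, sum_midTerm_of_odd m hc, Wnc_neg, sum_reducedTerm one_sub_q_pow_ne_zero
    h₀ _ (one_add_q_pow_ne_zero (m + 1)), sum_kummerTerm one_sub_q_pow_ne_zero h₀,
    prod_range_succ, prod_range_succ (fun j => 1 - q ^ c * q ^ (2 * j + 2)),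
    ← qPoch_self_mul_prod_one_add, pow_add q c]
  have h₁ := qPoch_mul_qPoch_two_mul_add_one m c
  have h₂ : ∏ j ∈ range m, (1 - q ^ c * q ^ (2 * j + 2)) =
      ∏ j ∈ range m, (1 - q ^ (c + 2 + 2 * j)) := prod_congr rfl fun j _ => by ring
  have h₃ : ∏ j ∈ range m, (1 - q ^ (c + 2 + 2 * j)) ≠ 0 := prod_ne_zero_iff.2 fun j _ => by
    convert one_sub_q_pow_ne_zero (c + 1 + 2 * j) using 2
    ring
  have h₄ := qPoch_self_ne_zero one_sub_q_pow_ne_zero (m + 1)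
  have h₅ := pow_ne_zero (2 * m) one_sub_q_ne_zero
  have h₆ := pow_ne_zero (c * m + 2 * (m + 1) * m) q_ne_zero
  have h₇ := h₀ (m + 1)
  have h₈ : 1 - q ^ c ≠ 0 := by simpa using h₀ 0
  have h₉ := h₀ (2 * m + 2)
  have h₁₀ := one_add_q_pow_ne_zero (m + 1)
  rw [h₂, show q ^ (2 * (m + 1)) = q ^ (2 * m + 2) by ring]
  generalize qPoch q (q ^ c * q ^ (m + 1) * q) m = P₁ at *
  generalize ∏ j ∈ range (m + 1), (1 - q ^ (c + 1 + 2 * j)) = P₂ at *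
  generalize ∏ j ∈ range m, (1 - q ^ (c + 2 + 2 * j)) = P₃ at *
  generalize ∏ j ∈ range m, (1 + q ^ (j + 1)) = P₄ at *
  generalize qPoch q (q ^ c * q) m = P₅ at *
  generalize qPoch q q m = P₆ at *
  generalize qPoch q q (m + 1) = P₇ at *
  generalize (1 - q) ^ (2 * m) = D at *
  generalize q ^ (c * m + 2 * (m + 1) * m) = e at *
  generalize q ^ c * q ^ (m + 1) = y at *
  generalize q ^ c * q ^ (2 * m + 2) = z at *
  generalize q ^ (m + 1) = N at *
  generalize q ^ c = x at *
  field_simp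
  linear_combination P₆ * P₄ * h₁

lemma prod_Icc_one_eq_prod_range {M : Type*} [CommMonoid M] (f : ℕ → M) (m : ℕ) :
    ∏ i ∈ Icc 1 m, f i = ∏ j ∈ range m, f (j + 1) := by
  rw [range_eq_Ico, prod_Ico_add' f 0 m 1]
  rfl

/-- **Lemma 13, first identity:** the denominator
`U_{n,c}(0) W_{n,c}(-n) - U_{n,c}(-n) W_{n,c}(0)` factorizes. -/
theorem statement15 (n c : ℕ) (hn : 1 ≤ n) :
    Unc n c 0 * Wnc n c (-(n : ℤ)) - Unc n c (-(n : ℤ)) * Wnc n c 0 =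
      2 * (∏ i ∈ Finset.Icc 1 (n - 1), (1 - q ^ (2 * i)) / (1 - q ^ 2)) *
        (1 + q) ^ (2 * n - 1) / q ^ (c * (n - 1) + 2 * n * (n - 1)) *
      (if Even c then
        1 / (1 + q) * ∏ i ∈ Finset.range (n - 1), (1 - q ^ (c + 2 + 2 * i)) / (1 - q ^ 2)
      else
        (∏ i ∈ Finset.range n, (1 - q ^ (c + 1 + 2 * i)) / (1 - q ^ 2)) *
          (1 - q) / (1 - q ^ (c + n))) := by
  obtain ⟨m, rfl⟩ : ∃ m, n = m + 1 := ⟨n - 1, by omega⟩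
  have h₁ := one_sub_q_ne_zero
  have h₂ : 1 + q ≠ 0 := by simpa using one_add_q_pow_ne_zero 1
  have h₃ : (1 : RatFunc ℚ) - q ^ 2 = (1 - q) * (1 + q) := by ring
  have h₄ := pow_ne_zero (c * m + 2 * (m + 1) * m) q_ne_zero
  rw [Nat.add_sub_cancel, prod_Icc_one_eq_prod_range]
  simp only [prod_div_distrib, prod_const, card_range, h₃, mul_pow]
  rw [show 2 * (m + 1) - 1 = 2 * m + 1 by omega]
  split_ifs with hc
  · rw [Unc_mul_Wnc_sub_of_even m hc]
    generalize q ^ (c * m + 2 * (m + 1) * m) = e at *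
    field_simp
    ring
  · have hc' := Nat.not_even_iff_odd.1 hc
    have h₅ : 1 - q ^ (c + (m + 1)) ≠ 0 := one_sub_q_pow_ne_zero (c + m)
    rw [Unc_mul_Wnc_sub_of_odd m hc']
    generalize q ^ (c * m + 2 * (m + 1) * m) = e at *
    field_simp
    ring
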